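/- Let n ≥ 4 be an integer and let x_1, …, x_{n-1} be nonnegative real numbers with x_1 + ⋯ + x_{n-1} = 1. Assume the (n-1)-variable inequality (n-1)·∑_{i=1}^{n-1} x_i³ + 1/(n-2) ≥ ((2n-3)/(n-2))·∑_{i=1}^{n-1} x_i². Then n·∑_{i=1}^{n-1} x_i³ + 1/(n-1) ≥ ((2n-1)/(n-1))·∑_{i=1}^{n-1} x_i². -/

import Mathlib

theorem stmt_4 (n : ℕ) (hn : 4 ≤ n) (x : Fin (n - 1) → ℝ)
    (hx : ∀ i, 0 ≤ x i) (hsum : ∑ i, x i = 1)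
    (ih : ((n : ℝ) - 1) * ∑ i, (x i) ^ 3 + 1 / ((n : ℝ) - 2) ≥
      ((2 * (n : ℝ) - 3) / ((n : ℝ) - 2)) * ∑ i, (x i) ^ 2) :
    (n : ℝ) * ∑ i, (x i) ^ 3 + 1 / ((n : ℝ) - 1) ≥
      ((2 * (n : ℝ) - 1) / ((n : ℝ) - 1)) * ∑ i, (x i) ^ 2 := by
  have hsq : 1 ≤ ((n : ℝ) - 1) * ∑ i, (x i) ^ 2 := by
    have h := sq_sum_le_card_mul_sum_sq (s := Finset.univ) (f := x)
    rw [hsum, Finset.card_univ, Fintype.card_fin, Nat.cast_sub (by omega)] at h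
    simpa using h
  have hn' : (4 : ℝ) ≤ n := by exact_mod_cast hn
  generalize ∑ i, (x i) ^ 2 = q at *
  generalize ∑ i, (x i) ^ 3 = c at *
  have h1 : (0 : ℝ) < n - 1 := by linarith
  have h2 : (0 : ℝ) < n - 2 := by linarith
  have key : (n : ℝ) * c + 1 / ((n : ℝ) - 1) - ((2 * (n : ℝ) - 1) / ((n : ℝ) - 1)) * q =
      n / (n - 1) * (((n : ℝ) - 1) * c + 1 / ((n : ℝ) - 2)
        - ((2 * (n : ℝ) - 3) / ((n : ℝ) - 2)) * q)
      + 2 * (((n : ℝ) - 1) * q - 1) / ((n - 1) * (n - 2)) := by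
    field_simp
    ring
  have hfirst := mul_nonneg (div_nonneg (Nat.cast_nonneg (α := ℝ) n) h1.le) (sub_nonneg.2 ih)
  have hsecond : 0 ≤ 2 * (((n : ℝ) - 1) * q - 1) / ((n - 1) * (n - 2)) :=
    div_nonneg (by linarith) (mul_pos h1 h2).le
  linarith
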